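/- arXiv:0803.3815 — 3 statements merged into one kernel-verified Lean document; each statement's English description precedes it below -/
import Mathlib

section
/- The theta function satisfies the addition formula θ(xy)θ(x/y)θ(zw)θ(z/w) = θ(xw)θ(x/w)θ(zy)θ(z/y) + (z/y)·θ(xz)θ(x/z)θ(yw)θ(y/w) for all nonzero x, y, z, w ∈ ℂ. -/
/-- The normalized Jacobi theta function
`θ(z;p) = ∏_{j=0}^∞ (1 - z p^j)(1 - p^{j+1}/z)`. -/
noncomputable def theta (p : ℝ) (z : ℂ) : ℂ :=
  ∏' j : ℕ, ((1 - z * (p : ℂ) ^ j) * (1 - (p : ℂ) ^ (j + 1) / z))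

open Filter Topology Finset

/-- The finite `q`-Pochhammer symbol `(p; p)_n`. -/
noncomputable def qPoch (p : ℂ) (n : ℕ) : ℂ := ∏ j ∈ range n, (1 - p ^ (j + 1))

/-- The reciprocal of `(p; p)_m`, extended by zero to negative integers `m`. -/
noncomputable def invQPoch (p : ℂ) (m : ℤ) : ℂ := if m < 0 then 0 else (qPoch p m.toNat)⁻¹

/-- The symmetric Gaussian binomial coefficient `[2n, n + k]_p`, for all integers `k`. -/
noncomputable def centralGaussBinom (p : ℂ) (n : ℕ) (k : ℤ) : ℂ :=
  qPoch p (2 * n) * invQPoch p (n + k) * invQPoch p (n - k)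

/-- The general term of the Laurent expansion of the theta function with nome `q ^ 2`. -/
noncomputable def thetaTerm (q z : ℂ) (k : ℤ) : ℂ := q ^ (k * (k - 1)) * (-z) ^ k

lemma one_sub_pow_succ_ne_zero {p : ℂ} (hp : ‖p‖ < 1) (j : ℕ) : 1 - p ^ (j + 1) ≠ 0 := by
  intro h
  have h1 : ‖p ^ (j + 1)‖ = 1 := by rw [← sub_eq_zero.mp h, norm_one]
  rw [norm_pow] at h1
  exact (pow_lt_one₀ (norm_nonneg p) hp j.succ_ne_zero).ne h1

lemma qPoch_succ (p : ℂ) (n : ℕ) : qPoch p (n + 1) = qPoch p n * (1 - p ^ (n + 1)) :=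
  prod_range_succ _ _

lemma exists_tendsto_qPoch {p : ℂ} (hp : ‖p‖ < 1) :
    ∃ c ≠ 0, Tendsto (qPoch p) atTop (𝓝 c) := by
  have hs : Summable fun j : ℕ => ‖-p ^ (j + 1)‖ := by
    simp only [norm_neg, norm_pow]
    exact (summable_nat_add_iff 1).mpr (summable_geometric_of_lt_one (norm_nonneg p) hp)
  refine ⟨∏' j : ℕ, (1 + -p ^ (j + 1)), tprod_one_add_ne_zero_of_summable (fun j => ?_) hs, ?_⟩
  · simpa [sub_eq_add_neg] using one_sub_pow_succ_ne_zero hp j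
  · have h := (multipliable_one_add_of_summable hs).hasProd.tendsto_prod_nat
    simp only [← sub_eq_add_neg] at h ⊢
    exact h

lemma invQPoch_natCast (p : ℂ) (n : ℕ) : invQPoch p n = (qPoch p n)⁻¹ := by
  simp [invQPoch]

lemma invQPoch_sub_one {p : ℂ} (hp : ‖p‖ < 1) (m : ℤ) :
    invQPoch p (m - 1) = (1 - p ^ m) * invQPoch p m := by
  rcases lt_trichotomy m 0 with h | rfl | h
  · simp [invQPoch, h, show m - 1 < 0 by lia]
  · simp [invQPoch]
  · obtain ⟨n, rfl⟩ : ∃ n : ℕ, m = n + 1 := ⟨(m - 1).toNat, by lia⟩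
    have h1 := one_sub_pow_succ_ne_zero hp n
    rw [add_sub_cancel_right, invQPoch_natCast, ← Nat.cast_succ, invQPoch_natCast, qPoch_succ,
      zpow_natCast]
    field_simp

lemma tendsto_invQPoch {p c : ℂ} (hc : c ≠ 0) (h : Tendsto (qPoch p) atTop (𝓝 c)) :
    Tendsto (invQPoch p) atTop (𝓝 c⁻¹) := by
  have h1 := (h.comp (tendsto_atTop_atTop.mpr fun b : ℕ => ⟨(b : ℤ), fun a ha =>
    (by lia : b ≤ a.toNat)⟩ : Tendsto Int.toNat atTop atTop)).inv₀ hc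
  refine h1.congr' ?_
  filter_upwards [eventually_ge_atTop 0] with m hm
  simp [invQPoch, not_lt.mpr hm]

lemma exists_norm_invQPoch_le {p : ℂ} (hp : ‖p‖ < 1) : ∃ B, ∀ m, ‖invQPoch p m‖ ≤ B := by
  obtain ⟨c, hc, h⟩ := exists_tendsto_qPoch hp
  obtain ⟨B, hB⟩ := (Metric.isBounded_range_of_tendsto _ (h.inv₀ hc)).exists_norm_le
  refine ⟨max B 0, fun m => ?_⟩
  by_cases hm : m < 0
  · simp [invQPoch, hm]
  · simpa [invQPoch, hm] using Or.inl (hB _ ⟨m.toNat, rfl⟩)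

lemma exists_norm_centralGaussBinom_le {p : ℂ} (hp : ‖p‖ < 1) :
    ∃ B, ∀ n k, ‖centralGaussBinom p n k‖ ≤ B := by
  obtain ⟨c, -, h⟩ := exists_tendsto_qPoch hp
  obtain ⟨A, hA⟩ := (Metric.isBounded_range_of_tendsto _ h).exists_norm_le
  obtain ⟨B, hB⟩ := exists_norm_invQPoch_le hp
  have hA' : ∀ n, ‖qPoch p n‖ ≤ A := fun n => hA _ ⟨n, rfl⟩
  have hA0 : 0 ≤ A := (norm_nonneg _).trans (hA' 0)
  have hB0 : 0 ≤ B := (norm_nonneg _).trans (hB 0)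
  refine ⟨A * B * B, fun n k => ?_⟩
  rw [centralGaussBinom, norm_mul, norm_mul]
  gcongr
  exacts [hA' _, hB _, hB _]

lemma tendsto_centralGaussBinom {p c : ℂ} (hc : c ≠ 0) (h : Tendsto (qPoch p) atTop (𝓝 c))
    (k : ℤ) : Tendsto (fun n => centralGaussBinom p n k) atTop (𝓝 c⁻¹) := by
  have h1 : Tendsto (fun n : ℕ => 2 * n) atTop atTop := tendsto_id.const_mul_atTop' two_pos
  have h2 : Tendsto (fun n : ℕ => (n : ℤ) + k) atTop atTop :=
    tendsto_atTop_add_const_right _ k tendsto_natCast_atTop_atTop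
  have h3 : Tendsto (fun n : ℕ => (n : ℤ) - k) atTop atTop :=
    tendsto_atTop_add_const_right _ (-k) tendsto_natCast_atTop_atTop
  have hi := tendsto_invQPoch hc h
  have := ((h.comp h1).mul (hi.comp h2)).mul (hi.comp h3)
  rwa [mul_inv_cancel₀ hc, one_mul] at this

lemma centralGaussBinom_succ {p : ℂ} (hp0 : p ≠ 0) (hp : ‖p‖ < 1) (n : ℕ) (k : ℤ) :
    centralGaussBinom p (n + 1) k = (1 + p ^ (2 * n + 1)) * centralGaussBinom p n k +
      p ^ (n - k + 1) * centralGaussBinom p n (k - 1) +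
      p ^ (n + k + 1) * centralGaussBinom p n (k + 1) := by
  have ha := invQPoch_sub_one hp (n + k + 1)
  have ha' := invQPoch_sub_one hp (n + k)
  have hb := invQPoch_sub_one hp (n - k + 1)
  have hb' := invQPoch_sub_one hp (n - k)
  have hAB : p ^ (2 * n + 1) = p ^ ((n : ℤ) + k) * p ^ ((n : ℤ) - k) * p := by
    rw [← zpow_add₀ hp0, ← zpow_add_one₀ hp0, ← zpow_natCast]
    congr 1
    push_cast
    ring
  rw [add_sub_cancel_right] at ha hb
  rw [ha] at ha'
  rw [hb] at hb'
  simp only [centralGaussBinom, show 2 * (n + 1) = 2 * n + 1 + 1 by ring, qPoch_succ,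
    pow_succ p (2 * n + 1), hAB]
  push_cast
  rw [show (n : ℤ) + 1 + k = n + k + 1 by ring, show (n : ℤ) + 1 - k = n - k + 1 by ring,
    show (n : ℤ) + (k - 1) = n + k - 1 by ring, show (n : ℤ) - (k - 1) = n - k + 1 by ring,
    show (n : ℤ) + (k + 1) = n + k + 1 by ring, show (n : ℤ) - (k + 1) = n - k - 1 by ring,
    ha, hb, ha', hb', zpow_add_one₀ hp0, zpow_add_one₀ hp0]
  ring

lemma thetaTerm_add_one {q z : ℂ} (hq : q ≠ 0) (hz : z ≠ 0) (k : ℤ) :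
    thetaTerm q z (k + 1) = -z * (q ^ 2) ^ k * thetaTerm q z k := by
  rw [thetaTerm, thetaTerm, zpow_add_one₀ (neg_ne_zero.mpr hz),
    show (k + 1) * (k + 1 - 1) = 2 * k + k * (k - 1) by ring, zpow_add₀ hq, zpow_mul, zpow_ofNat]
  ring

lemma hasSum_thetaTerm_mul_centralGaussBinom {q z : ℂ} (hq : q ≠ 0) (hq1 : ‖q ^ 2‖ < 1)
    (hz : z ≠ 0) (n : ℕ) :
    HasSum (fun k => thetaTerm q z k * centralGaussBinom (q ^ 2) n k)
      (∏ j ∈ range n, ((1 - z * (q ^ 2) ^ j) * (1 - (q ^ 2) ^ (j + 1) / z))) := by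
  induction n with
  | zero =>
    convert hasSum_single (0 : ℤ) fun k hk => ?_ using 1
    · simp [thetaTerm, centralGaussBinom, invQPoch, qPoch]
    · rcases lt_or_gt_of_ne hk with h | h <;> simp [centralGaussBinom, invQPoch, h]
  | succ n ih =>
    have hp0 : q ^ 2 ≠ 0 := pow_ne_zero 2 hq
    have hl := (Equiv.subRight (1 : ℤ)).hasSum_iff.mpr ih
    have hr := (Equiv.addRight (1 : ℤ)).hasSum_iff.mpr ih
    convert ((ih.mul_left (1 + (q ^ 2) ^ (2 * n + 1))).add
      (hl.mul_left (-z * (q ^ 2) ^ n))).add (hr.mul_left (-(q ^ 2) ^ (n + 1) / z)) using 1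
    · rfl
    · ext k
      have h1 := thetaTerm_add_one hq hz k
      have h2 := thetaTerm_add_one hq hz (k - 1)
      rw [sub_add_cancel] at h2
      have hk : (q ^ 2) ^ k ≠ 0 := zpow_ne_zero k hp0
      simp only [Function.comp_apply, Equiv.subRight_apply, Equiv.coe_addRight]
      rw [centralGaussBinom_succ hp0 hq1, h1, h2, zpow_add_one₀ hp0, zpow_add_one₀ hp0,
        zpow_add₀ hp0, zpow_sub_one₀ hp0, zpow_sub₀ hp0, zpow_natCast]
      field_simp
      ring
    · rw [prod_range_succ]
      field_simp
      ring

lemma summable_zpow_sq_mul_zpow {q z : ℂ} (hq : q ≠ 0) (hq1 : ‖q‖ < 1) (hz : z ≠ 0) :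
    Summable fun k : ℤ => q ^ (k * k) * z ^ k := by
  have hI : (Real.pi : ℂ) * Complex.I ≠ 0 := by simp [Real.pi_ne_zero]
  have him : 0 < (Complex.log q / (Real.pi * Complex.I)).im := by
    have h : Complex.log q / (Real.pi * Complex.I) =
        ((Real.pi⁻¹ : ℝ) : ℂ) * (-Complex.I * Complex.log q) := by
      push_cast
      field_simp
      simp
    rw [h, Complex.im_ofReal_mul]
    have := Real.log_neg (norm_pos_iff.mpr hq) hq1
    have := Real.pi_pos
    simp only [Complex.mul_im, Complex.neg_re, Complex.I_re, Complex.neg_im, Complex.I_im,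
      Complex.log_re]
    exact mul_pos (by positivity) (by linarith)
  refine ((summable_jacobiTheta₂_term_iff (Complex.log z / (2 * (Real.pi * Complex.I)))
    _).mpr him).congr fun k => ?_
  have h : q ^ (k * k) * z ^ k =
      Complex.exp (Complex.log q) ^ (k * k) * Complex.exp (Complex.log z) ^ k := by
    rw [Complex.exp_log hq, Complex.exp_log hz]
  rw [h, jacobiTheta₂_term, ← Complex.exp_int_mul, ← Complex.exp_int_mul, ← Complex.exp_add]
  congr 1
  push_cast
  field_simp
  ring

lemma summable_thetaTerm {q z : ℂ} (hq : q ≠ 0) (hq1 : ‖q‖ < 1) (hz : z ≠ 0) :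
    Summable (thetaTerm q z) := by
  refine (summable_zpow_sq_mul_zpow hq hq1 (div_ne_zero (neg_ne_zero.mpr hz) hq)).congr
    fun k => ?_
  rw [thetaTerm, mul_sub_one, zpow_sub₀ hq, div_zpow]
  ring

lemma tendsto_prod_theta {p : ℝ} (hp0 : 0 < p) (hp1 : p < 1) (z : ℂ) :
    Tendsto (fun n => ∏ j ∈ range n, ((1 - z * (p : ℂ) ^ j) * (1 - (p : ℂ) ^ (j + 1) / z)))
      atTop (𝓝 (theta p z)) := by
  have hs : Summable fun j : ℕ => p ^ j := summable_geometric_of_lt_one hp0.le hp1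
  have h1 : Summable fun j : ℕ => ‖-(z * (p : ℂ) ^ j)‖ := by
    simpa [abs_of_pos hp0] using hs.mul_left ‖z‖
  have h2 : Summable fun j : ℕ => ‖-((p : ℂ) ^ (j + 1) / z)‖ := by
    simpa [abs_of_pos hp0] using ((summable_nat_add_iff 1).mpr hs).div_const ‖z‖
  have h := (multipliable_one_add_of_summable h1).mul (multipliable_one_add_of_summable h2)
  simp only [← sub_eq_add_neg] at h
  exact h.hasProd.tendsto_prod_nat

/-- The Jacobi triple product, up to the value of the constant. -/
lemma exists_theta_eq_mul_tsum {p q : ℝ} (hq0 : 0 < q) (hq1 : q < 1) (hpq : p = q ^ 2) :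
    ∃ c : ℂ, ∀ z : ℂ, z ≠ 0 → theta p z = c * ∑' k, thetaTerm q z k := by
  have hq : (q : ℂ) ≠ 0 := by exact_mod_cast hq0.ne'
  have hqn : ‖(q : ℂ)‖ < 1 := by simpa [abs_of_pos hq0]
  have hpn : ‖(q : ℂ) ^ 2‖ < 1 := by
    rw [norm_pow]
    exact pow_lt_one₀ (norm_nonneg _) hqn two_ne_zero
  obtain ⟨c, hc, h⟩ := exists_tendsto_qPoch hpn
  obtain ⟨B, hB⟩ := exists_norm_centralGaussBinom_le hpn
  refine ⟨c⁻¹, fun z hz => ?_⟩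
  have hθ := tendsto_prod_theta (p := p) (by rw [hpq]; positivity)
    (by rw [hpq]; exact pow_lt_one₀ hq0.le hq1 two_ne_zero) z
  have hlim := tendsto_tsum_of_dominated_convergence
    ((summable_thetaTerm hq hqn hz).norm.mul_right B)
    (fun k => (tendsto_centralGaussBinom hc h k).const_mul (thetaTerm q z k))
    (Eventually.of_forall fun n k => by
      rw [norm_mul]
      gcongr
      exact hB n k)
  refine tendsto_nhds_unique hθ ?_
  rw [mul_comm, ← tsum_mul_right]
  refine hlim.congr fun n => ?_
  rw [(hasSum_thetaTerm_mul_centralGaussBinom hq hpn hz n).tsum_eq, hpq]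
  push_cast
  rfl

lemma HasSum.int_prod_of_even_odd {f : ℤ × ℤ → ℂ} {a b : ℂ}
    (ha : HasSum (fun t : ℤ × ℤ => f (t.1 + t.2 + 1, t.1 - t.2 + 1)) a)
    (hb : HasSum (fun t : ℤ × ℤ => f (t.1 + t.2 + 1, t.1 - t.2)) b) : HasSum f (a + b) := by
  let g : ℤ × ℤ → ℤ × ℤ := fun t => (t.1 + t.2 + 1, t.1 - t.2 + 1)
  let h : ℤ × ℤ → ℤ × ℤ := fun t => (t.1 + t.2 + 1, t.1 - t.2)
  have hg : Function.Injective g := fun s t hst => by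
    simp only [g, Prod.ext_iff] at hst ⊢
    lia
  have hh : Function.Injective h := fun s t hst => by
    simp only [h, Prod.ext_iff] at hst ⊢
    lia
  refine HasSum.add_isCompl (s := Set.range g) (t := Set.range h) ?_
    (hg.hasSum_range_iff.mpr ha) (hh.hasSum_range_iff.mpr hb)
  refine ⟨Set.disjoint_range_iff.mpr fun s t hst => ?_, codisjoint_iff_le_sup.mpr ?_⟩
  · simp only [g, h, Prod.ext_iff] at hst
    lia
  · rintro ⟨m, n⟩ -
    rcases Int.even_or_odd' (m + n) with ⟨u, hu | hu⟩
    · exact Or.inl ⟨(u - 1, m - u), by simp only [g, Prod.ext_iff]; lia⟩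
    · exact Or.inr ⟨(u, m - u - 1), by simp only [h, Prod.ext_iff]; lia⟩

lemma thetaTerm_mul_thetaTerm {q x y : ℂ} (hq : q ≠ 0) (hx : x ≠ 0) (hy : y ≠ 0) (m n : ℤ) :
    thetaTerm q (x * y) m * thetaTerm q (x / y) n =
      (-1) ^ (m + n) * q ^ (m * (m - 1) + n * (n - 1)) * x ^ (m + n) * y ^ (m - n) := by
  rw [thetaTerm, thetaTerm, ← neg_one_mul (x * y), ← neg_one_mul (x / y), zpow_add₀ hq,
    zpow_add₀ hx, zpow_sub₀ hy, zpow_add₀ (neg_ne_zero.mpr one_ne_zero)]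
  simp only [mul_zpow, div_zpow]
  ring

/-- The product `θ(xy) θ(x/y)` is, up to the factor `x`, a two by two determinant. -/
lemma exists_tsum_thetaTerm_mul_eq_det {q : ℂ} (hq : q ≠ 0) (hq1 : ‖q‖ < 1) :
    ∃ F G : ℂ → ℂ, ∀ x y : ℂ, x ≠ 0 → y ≠ 0 →
      (∑' k, thetaTerm q (x * y) k) * ∑' k, thetaTerm q (x / y) k =
        x * (G x * F y - F x * G y) := by
  have hq2 : q ^ 2 ≠ 0 := pow_ne_zero 2 hq
  have hqn : ‖q ^ 2‖ < 1 := by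
    rw [norm_pow]
    exact pow_lt_one₀ (norm_nonneg _) hq1 two_ne_zero
  let f : ℂ → ℤ → ℂ := fun x u => (q ^ 2) ^ (u * u) * (x ^ 2) ^ u
  let g : ℂ → ℤ → ℂ := fun x u => x * ((q ^ 2) ^ (u * u) * (q ^ 2 * x ^ 2) ^ u)
  have hf : ∀ x, x ≠ 0 → Summable (f x) := fun x hx =>
    summable_zpow_sq_mul_zpow hq2 hqn (pow_ne_zero 2 hx)
  have hg : ∀ x, x ≠ 0 → Summable (g x) := fun x hx =>
    (summable_zpow_sq_mul_zpow hq2 hqn (mul_ne_zero hq2 (pow_ne_zero 2 hx))).mul_left x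
  have hmul : ∀ {a b : ℤ → ℂ}, Summable a → Summable b →
      HasSum (fun t : ℤ × ℤ => a t.1 * b t.2) ((∑' u, a u) * ∑' v, b v) := fun ha hb =>
    ha.hasSum.mul hb.hasSum (summable_mul_of_summable_norm ha.norm hb.norm)
  refine ⟨fun x => ∑' u, f x u, fun x => ∑' u, g x u, fun x y hx hy => ?_⟩
  have hxy := hmul (summable_thetaTerm hq hq1 (mul_ne_zero hx hy))
    (summable_thetaTerm hq hq1 (div_ne_zero hx hy))
  refine hxy.unique ?_
  rw [mul_sub, sub_eq_add_neg, ← neg_mul]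
  refine HasSum.int_prod_of_even_odd ?_ ?_
  · convert (hmul (hg x hx) (hf y hy)).mul_left x using 1
    · rfl
    ext ⟨u, v⟩
    have he : Even (u + v + 1 + (u - v + 1)) := ⟨u + 1, by ring⟩
    rw [thetaTerm_mul_thetaTerm hq hx hy, he.neg_one_zpow,
      show (u + v + 1) * (u + v + 1 - 1) + (u - v + 1) * (u - v + 1 - 1) =
        2 * (u * u) + 2 * u + 2 * (v * v) by ring,
      show u + v + 1 + (u - v + 1) = 2 * u + 1 + 1 by ring,
      show u + v + 1 - (u - v + 1) = 2 * v by ring, zpow_add₀ hq, zpow_add₀ hq,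
      zpow_add_one₀ hx, zpow_add_one₀ hx]
    simp only [f, g, mul_zpow, zpow_mul, zpow_ofNat]
    ring
  · convert (hmul (hf x hx) (hg y hy)).mul_left (-x) using 1
    · rfl
    ext ⟨u, v⟩
    have ho : Odd (u + v + 1 + (u - v)) := ⟨u, by ring⟩
    rw [thetaTerm_mul_thetaTerm hq hx hy, ho.neg_one_zpow,
      show (u + v + 1) * (u + v + 1 - 1) + (u - v) * (u - v - 1) =
        2 * (u * u) + 2 * (v * v) + 2 * v by ring,
      show u + v + 1 + (u - v) = 2 * u + 1 by ring,
      show u + v + 1 - (u - v) = 2 * v + 1 by ring, zpow_add₀ hq, zpow_add₀ hq,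
      zpow_add_one₀ hx, zpow_add_one₀ hy]
    simp only [f, g, mul_zpow, zpow_mul, zpow_ofNat]
    ring

theorem theta_addition_formula (p : ℝ) (hp0 : 0 < p) (hp1 : p < 1)
    (x y z w : ℂ) (hx : x ≠ 0) (hy : y ≠ 0) (hz : z ≠ 0) (hw : w ≠ 0) :
    theta p (x * y) * theta p (x / y) * theta p (z * w) * theta p (z / w) =
      theta p (x * w) * theta p (x / w) * theta p (z * y) * theta p (z / y) +
        (z / y) * (theta p (x * z) * theta p (x / z) * theta p (y * w) * theta p (y / w)) := by
  have hq0 : 0 < √p := Real.sqrt_pos.mpr hp0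
  have hq1 : √p < 1 := (Real.sqrt_lt' one_pos).mpr (by simpa using hp1)
  obtain ⟨c, hc⟩ := exists_theta_eq_mul_tsum hq0 hq1 (Real.sq_sqrt hp0.le).symm
  obtain ⟨F, G, hFG⟩ := exists_tsum_thetaTerm_mul_eq_det (q := (√p : ℂ))
    (by exact_mod_cast hq0.ne') (by simpa [abs_of_pos hq0])
  have key : ∀ x y : ℂ, x ≠ 0 → y ≠ 0 →
      theta p (x * y) * theta p (x / y) = c ^ 2 * (x * (G x * F y - F x * G y)) := by
    intro x y hx hy
    rw [hc _ (mul_ne_zero hx hy), hc _ (div_ne_zero hx hy), ← hFG x y hx hy]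
    ring
  simp only [mul_assoc (_ * _) (theta p _) (theta p _), key _ _ hx hy, key _ _ hz hw,
    key _ _ hx hw, key _ _ hz hy, key _ _ hx hz, key _ _ hy hw]
  field_simp
  ring
end

section
/- The functions α and β satisfy α(λ,z)α(-λ,z) - β(λ,z)β(-λ,z) = q² θ(q^{-2}z)/θ(q²z) for all λ ∈ ℂ and z ∈ ℂ\{0} where both sides are defined. -/
/-- Complex power `q^w = exp(w log q)` for a real base `q > 0`. -/
noncomputable def qpow (q : ℝ) (w : ℂ) : ℂ :=
  Complex.exp (w * (Real.log q : ℂ))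

/-- `E(s) = q^s θ(q^{-2s}; p)`. -/
noncomputable def Efun (p q : ℝ) (s : ℂ) : ℂ :=
  qpow q s * theta p (qpow q (-(2 * s)))


/-- `α(λ,z) = θ(z)θ(q^{2(λ+1)}) / (θ(q²z)θ(q^{2λ}))`. -/
noncomputable def alphaF (p q : ℝ) (lam z : ℂ) : ℂ :=
  theta p z * theta p (qpow q (2 * (lam + 1))) /
    (theta p ((q : ℂ) ^ 2 * z) * theta p (qpow q (2 * lam)))

/-- `β(λ,z) = θ(q²)θ(q^{-2λ}z) / (θ(q²z)θ(q^{-2λ}))`. -/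
noncomputable def betaF (p q : ℝ) (lam z : ℂ) : ℂ :=
  theta p ((q : ℂ) ^ 2) * theta p (qpow q (-(2 * lam)) * z) /
    (theta p ((q : ℂ) ^ 2 * z) * theta p (qpow q (-(2 * lam))))

open Filter Topology

/-- The `q`-Pochhammer product `(w;p)_∞ = ∏_{j=0}^∞ (1 - w p^j)`. -/
noncomputable def pochhammerInf (p : ℝ) (w : ℂ) : ℂ :=
  ∏' j : ℕ, (1 - w * (p : ℂ) ^ j)

section Pochhammer

variable {p : ℝ}

lemma summable_norm_mul_pow (hp0 : 0 < p) (hp1 : p < 1) (w : ℂ) :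
    Summable fun j : ℕ ↦ ‖-(w * (p : ℂ) ^ j)‖ := by
  simpa [abs_of_pos hp0] using (summable_geometric_of_lt_one hp0.le hp1).mul_left ‖w‖

lemma multipliable_pochhammerInf (hp0 : 0 < p) (hp1 : p < 1) (w : ℂ) :
    Multipliable fun j : ℕ ↦ 1 - w * (p : ℂ) ^ j := by
  simpa [sub_eq_add_neg] using
    multipliable_one_add_of_summable (summable_norm_mul_pow hp0 hp1 w)

lemma pochhammerInf_eq_mul (hp0 : 0 < p) (hp1 : p < 1) (w : ℂ) :
    pochhammerInf p w = (1 - w) * pochhammerInf p (p * w) := by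
  have hm := multipliable_pochhammerInf hp0 hp1 (p * w)
  have heq : (fun j : ℕ ↦ 1 - p * w * (p : ℂ) ^ j) = fun j : ℕ ↦ 1 - w * (p : ℂ) ^ (j + 1) := by
    funext j
    ring
  rw [heq] at hm
  have h := tprod_eq_zero_mul' (f := fun j : ℕ ↦ 1 - w * (p : ℂ) ^ j) hm
  rw [pow_zero, mul_one, ← heq] at h
  exact h

lemma exists_mul_pow_eq_one_of_pochhammerInf_eq_zero (hp0 : 0 < p) (hp1 : p < 1) {w : ℂ}
    (h : pochhammerInf p w = 0) : ∃ j : ℕ, w * (p : ℂ) ^ j = 1 := by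
  by_contra! hne
  refine tprod_one_add_ne_zero_of_summable (f := fun j : ℕ ↦ -(w * (p : ℂ) ^ j))
    (fun j hj ↦ hne j ?_) (summable_norm_mul_pow hp0 hp1 w) ?_
  · linear_combination -hj
  · simpa [pochhammerInf, sub_eq_add_neg] using h

lemma differentiable_pochhammerInf (hp0 : 0 < p) (hp1 : p < 1) :
    Differentiable ℂ (pochhammerInf p) := by
  rw [← differentiableOn_univ]
  have hprod : HasProdLocallyUniformlyOn (fun (j : ℕ) (w : ℂ) ↦ 1 - w * (p : ℂ) ^ j)
      (pochhammerInf p) Set.univ := by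
    unfold pochhammerInf
    simp_rw [sub_eq_add_neg]
    refine hasProdLocallyUniformlyOn_of_forall_compact isOpen_univ fun K _ hK ↦ ?_
    obtain ⟨C, hC⟩ := hK.isBounded.exists_norm_le
    refine ((summable_geometric_of_lt_one hp0.le hp1).mul_left C).hasProdUniformlyOn_nat_one_add
      hK (.of_forall fun n x hx ↦ ?_) (fun _ ↦ by fun_prop)
    simpa [abs_of_pos hp0] using mul_le_mul_of_nonneg_right (hC x hx) (pow_nonneg hp0.le n)
  exact hprod.differentiableOn
    (.of_forall fun _ ↦ by simpa [Finset.prod_fn] using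
      DifferentiableOn.finsetProd (fun _ _ ↦ by fun_prop)) isOpen_univ

end Pochhammer

section Theta

variable {p : ℝ}

lemma theta_eq_pochhammerInf_mul (hp0 : 0 < p) (hp1 : p < 1) (w : ℂ) :
    theta p w = pochhammerInf p w * pochhammerInf p (p / w) := by
  have heq : (fun j : ℕ ↦ (1 - w * (p : ℂ) ^ j) * (1 - (p : ℂ) ^ (j + 1) / w)) =
      fun j : ℕ ↦ (1 - w * (p : ℂ) ^ j) * (1 - p / w * (p : ℂ) ^ j) := by
    funext j
    ring
  rw [theta, heq, (multipliable_pochhammerInf hp0 hp1 w).tprod_mul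
    (multipliable_pochhammerInf hp0 hp1 (p / w))]
  rfl

lemma theta_eq_one_sub_mul (hp0 : 0 < p) (hp1 : p < 1) (w : ℂ) :
    theta p w = (1 - w) * (pochhammerInf p (p * w) * pochhammerInf p (p / w)) := by
  rw [theta_eq_pochhammerInf_mul hp0 hp1, pochhammerInf_eq_mul hp0 hp1 w, mul_assoc]

lemma theta_mul_left (hp0 : 0 < p) (hp1 : p < 1) {w : ℂ} (hw : w ≠ 0) :
    theta p (p * w) = -w⁻¹ * theta p w := by
  have hp : (p : ℂ) ≠ 0 := by exact_mod_cast hp0.ne'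
  rw [theta_eq_pochhammerInf_mul hp0 hp1, theta_eq_one_sub_mul hp0 hp1 w,
    pochhammerInf_eq_mul hp0 hp1 (p / (p * w)), show (p : ℂ) / (p * w) = w⁻¹ by field_simp,
    ← div_eq_mul_inv]
  field_simp
  ring

lemma theta_div_left (hp0 : 0 < p) (hp1 : p < 1) {w : ℂ} (hw : w ≠ 0) :
    theta p (w / p) = -(w / p) * theta p w := by
  have hp : (p : ℂ) ≠ 0 := by exact_mod_cast hp0.ne'
  have h := theta_mul_left hp0 hp1 (div_ne_zero hw hp)
  rw [mul_div_cancel₀ _ hp] at h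
  rw [h]
  field_simp

lemma theta_inv (hp0 : 0 < p) (hp1 : p < 1) {w : ℂ} (hw : w ≠ 0) :
    theta p w⁻¹ = -w⁻¹ * theta p w := by
  have hp : (p : ℂ) ≠ 0 := by exact_mod_cast hp0.ne'
  rw [← theta_mul_left hp0 hp1 hw, theta_eq_pochhammerInf_mul hp0 hp1,
    theta_eq_pochhammerInf_mul hp0 hp1, show (p : ℂ) / (p * w) = w⁻¹ by field_simp, div_inv_eq_mul,
    mul_comm]

lemma theta_one (hp0 : 0 < p) (hp1 : p < 1) : theta p 1 = 0 := by
  simp [theta_eq_one_sub_mul hp0 hp1]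

lemma differentiableAt_theta (hp0 : 0 < p) (hp1 : p < 1) {w : ℂ} (hw : w ≠ 0) :
    DifferentiableAt ℂ (theta p) w := by
  have hP := differentiable_pochhammerInf hp0 hp1
  rw [funext (theta_eq_pochhammerInf_mul hp0 hp1)]
  exact (hP w).mul ((hP _).comp w (f := fun w : ℂ ↦ (p : ℂ) / w) (by fun_prop (disch := assumption)))

lemma exists_zpow_eq_of_theta_eq_zero (hp0 : 0 < p) (hp1 : p < 1) {w : ℂ} (hw : w ≠ 0)
    (h : theta p w = 0) : ∃ k : ℤ, w = (p : ℂ) ^ k := by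
  have hp : (p : ℂ) ≠ 0 := by exact_mod_cast hp0.ne'
  rw [theta_eq_pochhammerInf_mul hp0 hp1, mul_eq_zero] at h
  rcases h with h | h <;>
    obtain ⟨j, hj⟩ := exists_mul_pow_eq_one_of_pochhammerInf_eq_zero hp0 hp1 h
  · refine ⟨-j, ?_⟩
    rw [zpow_neg, zpow_natCast]
    exact eq_inv_of_mul_eq_one_left hj
  · refine ⟨j + 1, ?_⟩
    rw [zpow_add_one₀ hp, zpow_natCast]
    field_simp at hj
    linear_combination -hj

lemma theta_zpow (hp0 : 0 < p) (hp1 : p < 1) (k : ℤ) : theta p ((p : ℂ) ^ k) = 0 := by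
  have hp : (p : ℂ) ≠ 0 := by exact_mod_cast hp0.ne'
  induction k with
  | zero => simp [theta_one hp0 hp1]
  | succ k ih =>
    rw [zpow_add_one₀ hp, mul_comm, theta_mul_left hp0 hp1 (zpow_ne_zero _ hp), ih, mul_zero]
  | pred k ih =>
    rw [zpow_sub_one₀ hp, ← div_eq_mul_inv, theta_div_left hp0 hp1 (zpow_ne_zero _ hp), ih,
      mul_zero]

lemma deriv_theta_one_ne_zero (hp0 : 0 < p) (hp1 : p < 1) : deriv (theta p) 1 ≠ 0 := by
  have hP := differentiable_pochhammerInf hp0 hp1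
  have hpoch : pochhammerInf p p ≠ 0 := fun h ↦ by
    obtain ⟨j, hj⟩ := exists_mul_pow_eq_one_of_pochhammerInf_eq_zero hp0 hp1 h
    rw [← pow_succ'] at hj
    exact (pow_lt_one₀ hp0.le hp1 j.succ_ne_zero).ne (by exact_mod_cast hj)
  have hd : DifferentiableAt ℂ
      (fun w : ℂ ↦ pochhammerInf p (p * w) * pochhammerInf p (p / w)) 1 :=
    ((hP _).comp 1 (f := fun w : ℂ ↦ (p : ℂ) * w) (by fun_prop)).mul
      ((hP _).comp 1 (f := fun w : ℂ ↦ (p : ℂ) / w) (by fun_prop (disch := exact one_ne_zero)))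
  have h1 : HasDerivAt (fun w : ℂ ↦ 1 - w) (-1) 1 := (hasDerivAt_id _).const_sub 1
  rw [funext (theta_eq_one_sub_mul hp0 hp1), (h1.fun_mul hd.hasDerivAt).deriv]
  simpa using hpoch

/-- Differentiating `θ(pw) = -θ(w)/w` at a zero of `θ`. -/
lemma deriv_theta_mul_left (hp0 : 0 < p) (hp1 : p < 1) {w : ℂ} (hw : w ≠ 0)
    (h : theta p w = 0) : deriv (theta p) (p * w) * p = -w⁻¹ * deriv (theta p) w := by
  have hp : (p : ℂ) ≠ 0 := by exact_mod_cast hp0.ne'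
  have hl : HasDerivAt (fun v : ℂ ↦ theta p (p * v)) (deriv (theta p) (p * w) * p) w :=
    (differentiableAt_theta hp0 hp1 (mul_ne_zero hp hw)).hasDerivAt.comp w
      (by simpa using (hasDerivAt_id w).const_mul (p : ℂ))
  have hr := (hasDerivAt_inv hw).fun_neg.fun_mul (differentiableAt_theta hp0 hp1 hw).hasDerivAt
  have heq : (fun v : ℂ ↦ theta p (p * v)) =ᶠ[𝓝 w] fun v ↦ -v⁻¹ * theta p v := by
    filter_upwards [isOpen_ne.mem_nhds hw] with v hv using theta_mul_left hp0 hp1 hv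
  rw [hl.unique (hr.congr_of_eventuallyEq heq), h]
  ring

lemma deriv_theta_zpow_ne_zero (hp0 : 0 < p) (hp1 : p < 1) (k : ℤ) :
    deriv (theta p) ((p : ℂ) ^ k) ≠ 0 := by
  have hp : (p : ℂ) ≠ 0 := by exact_mod_cast hp0.ne'
  have step (k : ℤ) : deriv (theta p) ((p : ℂ) ^ (k + 1)) * p =
      -((p : ℂ) ^ k)⁻¹ * deriv (theta p) ((p : ℂ) ^ k) := by
    rw [zpow_add_one₀ hp, mul_comm ((p : ℂ) ^ k)]
    exact deriv_theta_mul_left hp0 hp1 (zpow_ne_zero k hp) (theta_zpow hp0 hp1 k)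
  induction k with
  | zero => simpa using deriv_theta_one_ne_zero hp0 hp1
  | succ k ih =>
    intro h
    have := step k
    rw [h, zero_mul] at this
    exact mul_ne_zero (neg_ne_zero.2 (inv_ne_zero (zpow_ne_zero _ hp))) ih this.symm
  | pred k ih =>
    intro h
    have := step (-(k : ℤ) - 1)
    rw [h, mul_zero, sub_add_cancel] at this
    exact mul_ne_zero ih hp this

lemma deriv_theta_ne_zero_of_theta_eq_zero (hp0 : 0 < p) (hp1 : p < 1) {w : ℂ} (hw : w ≠ 0)
    (h : theta p w = 0) : deriv (theta p) w ≠ 0 := by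
  obtain ⟨k, rfl⟩ := exists_zpow_eq_of_theta_eq_zero hp0 hp1 hw h
  exact deriv_theta_zpow_ne_zero hp0 hp1 k

end Theta

section Quotient

/-- If every zero of the entire function `G` is simple and a zero of `F`, then `G` divides `F`. -/
lemma exists_differentiable_eq_mul_of_simple_zeros {F G : ℂ → ℂ} (hF : Differentiable ℂ F)
    (hG : Differentiable ℂ G) (h : ∀ u, G u = 0 → F u = 0 ∧ deriv G u ≠ 0) :
    ∃ H : ℂ → ℂ, Differentiable ℂ H ∧ ∀ u, F u = H u * G u := by
  classical
  refine ⟨fun u ↦ if G u = 0 then deriv F u / deriv G u else F u / G u, fun u ↦ ?_, fun u ↦ ?_⟩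
  · by_cases hu : G u = 0
    · obtain ⟨hFu, hdG⟩ := h u hu
      have hdF' : DifferentiableAt ℂ (dslope F u) u :=
        ((Complex.differentiableOn_dslope univ_mem).2 hF.differentiableOn).differentiableAt
          univ_mem
      have hdG' : DifferentiableAt ℂ (dslope G u) u :=
        ((Complex.differentiableOn_dslope univ_mem).2 hG.differentiableOn).differentiableAt
          univ_mem
      have hne : dslope G u u ≠ 0 := by rwa [dslope_same]
      refine (hdF'.div hdG' hne).congr_of_eventuallyEq ?_
      filter_upwards [hdG'.continuousAt.eventually_ne hne] with v hv
      rcases eq_or_ne v u with rfl | hvu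
      · simp [hu]
      · rw [Pi.div_apply]
        rw [dslope_of_ne _ hvu, slope_def_field, hu, sub_zero] at hv
        rw [dslope_of_ne _ hvu, dslope_of_ne _ hvu, slope_def_field, slope_def_field, hu, hFu,
          sub_zero, sub_zero]
        have hv' : v - u ≠ 0 := sub_ne_zero.2 hvu
        have hGv : G v ≠ 0 := fun h0 ↦ hv (by simp [h0])
        simp only [hGv, if_false]
        field_simp
    · refine ((hF u).div (hG u) hu).congr_of_eventuallyEq ?_
      filter_upwards [(hG u).continuousAt.eventually_ne hu] with v hv
      simp [hv]
  · by_cases hu : G u = 0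
    · simp [hu, (h u hu).1]
    · simp [hu]

/-- An entire function with a positive real period and period `2πi` is constant. -/
lemma Differentiable.eq_of_periodic_of_periodic_two_pi_I {H : ℂ → ℂ} (hH : Differentiable ℂ H)
    {ω : ℝ} (hω : 0 < ω) (h1 : Function.Periodic H (ω : ℂ))
    (h2 : Function.Periodic H (2 * Real.pi * Complex.I)) (u v : ℂ) : H u = H v := by
  refine hH.apply_eq_apply_of_bounded ?_ u v
  refine ((isCompact_closedBall (0 : ℂ) (ω + 2 * Real.pi)).image hH.continuous).isBounded.subset ?_
  rintro _ ⟨w, rfl⟩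
  have hπ : 0 < 2 * Real.pi := Real.two_pi_pos
  refine ⟨w - ⌊w.re / ω⌋ • (ω : ℂ) - ⌊w.im / (2 * Real.pi)⌋ • (2 * Real.pi * Complex.I), ?_, ?_⟩
  · rw [mem_closedBall_zero_iff]
    refine (Complex.norm_le_abs_re_add_abs_im _).trans (add_le_add ?_ ?_)
    · have hfl := Int.floor_le (w.re / ω)
      have hlt := Int.lt_floor_add_one (w.re / ω)
      rw [le_div_iff₀ hω] at hfl
      rw [div_lt_iff₀ hω] at hlt
      have : (w - ⌊w.re / ω⌋ • (ω : ℂ) -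
          ⌊w.im / (2 * Real.pi)⌋ • (2 * Real.pi * Complex.I)).re = w.re - ⌊w.re / ω⌋ * ω := by
        simp
      rw [this, abs_le]
      constructor <;> linarith
    · have hfl := Int.floor_le (w.im / (2 * Real.pi))
      have hlt := Int.lt_floor_add_one (w.im / (2 * Real.pi))
      rw [le_div_iff₀ hπ] at hfl
      rw [div_lt_iff₀ hπ] at hlt
      have : (w - ⌊w.re / ω⌋ • (ω : ℂ) -
          ⌊w.im / (2 * Real.pi)⌋ • (2 * Real.pi * Complex.I)).im =
            w.im - ⌊w.im / (2 * Real.pi)⌋ * (2 * Real.pi) := by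
        simp
      rw [this, abs_le]
      constructor <;> linarith
  · rw [h2.sub_zsmul_eq, h1.sub_zsmul_eq]

/-- If `F = H * G` and `F`, `G` acquire the same factor under translation by `ω`, then `H` has
period `ω`. -/
lemma periodic_of_eq_mul {F G H c : ℂ → ℂ} (hG : Differentiable ℂ G) (hH : Continuous H)
    (h : ∀ u, G u = 0 → deriv G u ≠ 0) (hFGH : ∀ u, F u = H u * G u) {ω : ℂ}
    (hc : ∀ u, c u ≠ 0) (hFω : ∀ u, F (u + ω) = c u * F u) (hGω : ∀ u, G (u + ω) = c u * G u) :
    Function.Periodic H ω := by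
  have key (u : ℂ) (hu : G u ≠ 0) : H (u + ω) = H u := by
    have := hFω u
    rw [hFGH, hFGH, hGω] at this
    refine mul_right_cancel₀ (mul_ne_zero (hc u) hu) ?_
    linear_combination this
  intro u
  by_cases hu : G u = 0
  · have hev : ∀ᶠ v in 𝓝[≠] u, H (v + ω) = H v :=
      ((hG u).hasDerivAt.eventually_ne (h u hu)).mono fun v hv ↦ key v hv
    refine tendsto_nhds_unique_of_frequently_eq (f := fun v ↦ H (v + ω)) (g := H)
      (Continuous.tendsto (by fun_prop) u) (hH.tendsto u)
      (hev.frequently.filter_mono nhdsWithin_le_nhds)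
  · exact key u hu

end Quotient

section Addition

variable {p : ℝ}

lemma theta_mul_mul_theta_div_left (hp0 : 0 < p) (hp1 : p < 1) {a L : ℂ} (ha : a ≠ 0)
    (hL : L ≠ 0) : theta p (a * (p * L)) * theta p (a / (p * L)) =
      (p * L ^ 2)⁻¹ * (theta p (a * L) * theta p (a / L)) := by
  have hp : (p : ℂ) ≠ 0 := by exact_mod_cast hp0.ne'
  rw [mul_left_comm, theta_mul_left hp0 hp1 (mul_ne_zero ha hL),
    show a / (p * L) = a / L / p by field_simp, theta_div_left hp0 hp1 (div_ne_zero ha hL)]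
  field_simp

lemma differentiable_theta_mul_exp_mul_theta_div_exp (hp0 : 0 < p) (hp1 : p < 1) {a : ℂ}
    (ha : a ≠ 0) :
    Differentiable ℂ fun u ↦ theta p (a * Complex.exp u) * theta p (a / Complex.exp u) := by
  intro u
  have he := Complex.exp_ne_zero u
  exact ((differentiableAt_theta hp0 hp1 (mul_ne_zero ha he)).comp u
    (f := fun u ↦ a * Complex.exp u) (by fun_prop)).mul
    ((differentiableAt_theta hp0 hp1 (div_ne_zero ha he)).comp u
      (f := fun u ↦ a / Complex.exp u) (by fun_prop (disch := exact he)))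

/-- For `z² ∉ p^ℤ` the zeros of `u ↦ θ(z eᵘ)θ(z e⁻ᵘ)` are simple. -/
lemma deriv_theta_mul_exp_mul_theta_div_exp_ne_zero (hp0 : 0 < p) (hp1 : p < 1) {z : ℂ}
    (hz : z ≠ 0) (hz2 : ∀ k : ℤ, z ^ 2 ≠ (p : ℂ) ^ k) {u : ℂ}
    (hu : theta p (z * Complex.exp u) * theta p (z / Complex.exp u) = 0) :
    deriv (fun u ↦ theta p (z * Complex.exp u) * theta p (z / Complex.exp u)) u ≠ 0 := by
  have hp : (p : ℂ) ≠ 0 := by exact_mod_cast hp0.ne'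
  have he := Complex.exp_ne_zero u
  have hm := mul_ne_zero hz he
  have hd := div_ne_zero hz he
  have h1 := (differentiableAt_theta hp0 hp1 hm).hasDerivAt.comp u
    ((Complex.hasDerivAt_exp u).const_mul z)
  have h2 := (differentiableAt_theta hp0 hp1 hd).hasDerivAt.comp u
    ((Complex.hasDerivAt_exp u).fun_inv he |>.const_mul z)
  have hnot : ¬ (theta p (z * Complex.exp u) = 0 ∧ theta p (z / Complex.exp u) = 0) := by
    rintro ⟨ha, hb⟩
    obtain ⟨k, hk⟩ := exists_zpow_eq_of_theta_eq_zero hp0 hp1 hm ha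
    obtain ⟨l, hl⟩ := exists_zpow_eq_of_theta_eq_zero hp0 hp1 hd hb
    refine hz2 (k + l) ?_
    rw [zpow_add₀ hp, ← hk, ← hl]
    field_simp
  have hD := (h1.fun_mul h2).deriv
  simp only [Function.comp_def, ← div_eq_mul_inv] at hD
  rw [hD]
  rcases mul_eq_zero.1 hu with h | h
  · rw [h, zero_mul, add_zero]
    exact mul_ne_zero (mul_ne_zero (deriv_theta_ne_zero_of_theta_eq_zero hp0 hp1 hm h) hm)
      fun h' ↦ hnot ⟨h, h'⟩
  · rw [h, mul_zero, zero_add]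
    refine mul_ne_zero (fun h' ↦ hnot ⟨h', h⟩)
      (mul_ne_zero (deriv_theta_ne_zero_of_theta_eq_zero hp0 hp1 hd h) ?_)
    simp [hz]

/-- At the zeros of `L ↦ θ(zL)θ(z/L)` the other two products of the addition formula agree. -/
lemma theta_addition_of_theta_mul_theta_div_eq_zero (hp0 : 0 < p) (hp1 : p < 1) {a z L : ℂ}
    (ha : a ≠ 0) (hz : z ≠ 0) (hL : L ≠ 0) (h : theta p (z * L) * theta p (z / L) = 0) :
    theta p z ^ 2 * (theta p (a * L) * theta p (a / L)) -
      a * theta p (z / a) * theta p (a * z) * (theta p (1 * L) * theta p (1 / L)) = 0 := by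
  have hp : (p : ℂ) ≠ 0 := by exact_mod_cast hp0.ne'
  set F : ℂ → ℂ := fun L ↦ theta p z ^ 2 * (theta p (a * L) * theta p (a / L)) -
    a * theta p (z / a) * theta p (a * z) * (theta p (1 * L) * theta p (1 / L)) with hFdef
  have hshift (L : ℂ) (hL : L ≠ 0) : F (p * L) = (p * L ^ 2)⁻¹ * F L := by
    simp only [hFdef, theta_mul_mul_theta_div_left hp0 hp1 ha hL,
      theta_mul_mul_theta_div_left hp0 hp1 one_ne_zero hL]
    ring
  have hinv (L : ℂ) : F L⁻¹ = F L := by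
    simp only [hFdef, div_inv_eq_mul, ← div_eq_mul_inv]
    ring
  have hzero (k : ℤ) : F (z * (p : ℂ) ^ k) = 0 := by
    induction k with
    | zero =>
      simp only [hFdef, zpow_zero, mul_one, one_mul, one_div, theta_inv hp0 hp1 hz]
      rw [← inv_div z a, theta_inv hp0 hp1 (div_ne_zero hz ha)]
      field_simp
      ring
    | succ k ih =>
      rw [zpow_add_one₀ hp, ← mul_assoc, mul_comm _ (p : ℂ),
        hshift _ (mul_ne_zero hz (zpow_ne_zero _ hp)), ih, mul_zero]
    | pred k ih =>
      have hne : z * (p : ℂ) ^ (-(k : ℤ) - 1) ≠ 0 := mul_ne_zero hz (zpow_ne_zero _ hp)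
      have hs := hshift _ hne
      rw [mul_left_comm, ← zpow_one_add₀ hp, add_sub_cancel, ih] at hs
      exact (mul_eq_zero.1 hs.symm).resolve_left
        (inv_ne_zero (mul_ne_zero hp (pow_ne_zero 2 hne)))
  change F L = 0
  rcases mul_eq_zero.1 h with h | h
  · obtain ⟨k, hk⟩ := exists_zpow_eq_of_theta_eq_zero hp0 hp1 (mul_ne_zero hz hL) h
    rw [← hinv, ← hzero (-k), zpow_neg, ← hk]
    congr 1
    field_simp
  · obtain ⟨k, hk⟩ := exists_zpow_eq_of_theta_eq_zero hp0 hp1 (div_ne_zero hz hL) h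
    rw [← hzero (-k), zpow_neg, ← hk]
    congr 1
    field_simp

/-- The addition formula when `z² ∉ p^ℤ`. -/
lemma theta_addition_of_sq_ne_zpow (hp0 : 0 < p) (hp1 : p < 1) {a z L : ℂ}
    (ha : a ≠ 0) (hz : z ≠ 0) (hz2 : ∀ k : ℤ, z ^ 2 ≠ (p : ℂ) ^ k) (hL : L ≠ 0) :
    theta p z ^ 2 * (theta p (a * L) * theta p (a / L)) -
      theta p a ^ 2 * (theta p (z * L) * theta p (z / L)) =
      a * theta p (z / a) * theta p (a * z) * (theta p L * theta p L⁻¹) := by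
  have hp : (p : ℂ) ≠ 0 := by exact_mod_cast hp0.ne'
  have hθz : theta p z ≠ 0 := fun h ↦ by
    obtain ⟨k, rfl⟩ := exists_zpow_eq_of_theta_eq_zero hp0 hp1 hz h
    exact hz2 (k * 2) (by rw [zpow_mul, zpow_ofNat])
  set A : ℂ → ℂ → ℂ :=
    fun b u ↦ theta p (b * Complex.exp u) * theta p (b / Complex.exp u) with hA
  have hAd {b : ℂ} (hb : b ≠ 0) : Differentiable ℂ (A b) :=
    differentiable_theta_mul_exp_mul_theta_div_exp hp0 hp1 hb
  have hAω {b : ℂ} (hb : b ≠ 0) (u : ℂ) : A b (u + (-Real.log p : ℝ)) =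
      (p : ℂ)⁻¹ * Complex.exp u ^ 2 * A b u := by
    have hexp : Complex.exp u = p * Complex.exp (u + (-Real.log p : ℝ)) := by
      rw [Complex.exp_add, ← Complex.ofReal_exp, Real.exp_neg, Real.exp_log hp0]
      push_cast
      field_simp
    have he := Complex.exp_ne_zero (u + (-Real.log p : ℝ))
    simp only [hA]
    rw [hexp, theta_mul_mul_theta_div_left hp0 hp1 hb he]
    field_simp
  have hA2 (b u : ℂ) : A b (u + 2 * Real.pi * Complex.I) = A b u := by
    simp only [hA, Complex.exp_periodic u]
  set F : ℂ → ℂ := fun u ↦ theta p z ^ 2 * A a u -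
    a * theta p (z / a) * theta p (a * z) * A 1 u with hF
  have hFd : Differentiable ℂ F :=
    ((hAd ha).const_mul _).sub ((hAd one_ne_zero).const_mul _)
  have hsimple (u : ℂ) (hu : A z u = 0) : F u = 0 ∧ deriv (A z) u ≠ 0 :=
    ⟨theta_addition_of_theta_mul_theta_div_eq_zero hp0 hp1 ha hz (Complex.exp_ne_zero u) hu,
      deriv_theta_mul_exp_mul_theta_div_exp_ne_zero hp0 hp1 hz hz2 hu⟩
  obtain ⟨H, hH, hFH⟩ := exists_differentiable_eq_mul_of_simple_zeros hFd (hAd hz) hsimple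
  have hconst := hH.eq_of_periodic_of_periodic_two_pi_I (ω := -Real.log p)
    (neg_pos.2 (Real.log_neg hp0 hp1))
    (periodic_of_eq_mul (c := fun u ↦ (p : ℂ)⁻¹ * Complex.exp u ^ 2) (hAd hz) hH.continuous
      (fun u hu ↦ (hsimple u hu).2) hFH
      (fun u ↦ mul_ne_zero (inv_ne_zero hp) (pow_ne_zero 2 (Complex.exp_ne_zero u)))
      (fun u ↦ by simp only [hF, hAω ha, hAω one_ne_zero]; ring) (hAω hz))
    (periodic_of_eq_mul (c := fun _ ↦ 1) (hAd hz) hH.continuous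
      (fun u hu ↦ (hsimple u hu).2) hFH (fun _ ↦ one_ne_zero)
      (fun u ↦ by simp only [hF, hA2, one_mul]) (fun u ↦ by rw [hA2, one_mul]))
  have hH0 : H 0 = theta p a ^ 2 := by
    have h0 := hFH 0
    simp only [hF, hA, Complex.exp_zero, mul_one, div_one, theta_one hp0 hp1, mul_zero,
      sub_zero] at h0
    refine mul_right_cancel₀ (pow_ne_zero 2 hθz) ?_
    linear_combination -h0
  have hlog := hFH (Complex.log L)
  rw [hconst _ 0, hH0] at hlog
  simp only [hF, hA, Complex.exp_log hL, one_mul, one_div] at hlog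
  linear_combination hlog

lemma dense_compl_sq_eq_zpow (hp0 : 0 < p) :
    Dense ({z : ℂ | z = 0 ∨ ∃ k : ℤ, z ^ 2 = (p : ℂ) ^ k}ᶜ) := by
  refine Set.Countable.dense_compl ℂ ?_
  refine (((Set.countable_singleton (0 : ℂ)).union
    (Set.countable_range fun k : ℤ ↦ ((Real.sqrt p : ℝ) : ℂ) ^ k)).union
    (Set.countable_range fun k : ℤ ↦ -((Real.sqrt p : ℝ) : ℂ) ^ k)).mono ?_
  rintro z (rfl | ⟨k, hk⟩)
  · simp
  · have hsq : z ^ 2 = (((Real.sqrt p : ℝ) : ℂ) ^ k) ^ 2 := by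
      rw [hk, ← zpow_natCast, zpow_comm, zpow_natCast, ← Complex.ofReal_pow, Real.sq_sqrt hp0.le]
    rcases sq_eq_sq_iff_eq_or_eq_neg.1 hsq with h | h
    · exact Or.inl (Or.inr ⟨k, h.symm⟩)
    · exact Or.inr ⟨k, h.symm⟩

/-- The three-term addition formula for `θ`, in multiplicative variables `a`, `z`, `L`. -/
theorem theta_addition (hp0 : 0 < p) (hp1 : p < 1) {a z L : ℂ}
    (ha : a ≠ 0) (hz : z ≠ 0) (hL : L ≠ 0) :
    theta p z ^ 2 * (theta p (a * L) * theta p (a / L)) -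
      theta p a ^ 2 * (theta p (z * L) * theta p (z / L)) =
      a * theta p (z / a) * theta p (a * z) * (theta p L * theta p L⁻¹) := by
  have hcont {w : ℂ} (hw : w ≠ 0) : ContinuousAt (theta p) w :=
    (differentiableAt_theta hp0 hp1 hw).continuousAt
  have h0 := hcont hz
  have h1 : ContinuousAt (fun z ↦ theta p (z * L)) z :=
    (hcont (mul_ne_zero hz hL)).comp (f := fun z ↦ z * L) (by fun_prop)
  have h2 : ContinuousAt (fun z ↦ theta p (z / L)) z :=
    (hcont (div_ne_zero hz hL)).comp (f := fun z ↦ z / L) (by fun_prop)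
  have h3 : ContinuousAt (fun z ↦ theta p (z / a)) z :=
    (hcont (div_ne_zero hz ha)).comp (f := fun z ↦ z / a) (by fun_prop)
  have h4 : ContinuousAt (fun z ↦ theta p (a * z)) z :=
    (hcont (mul_ne_zero ha hz)).comp (f := fun z ↦ a * z) (by fun_prop)
  refine tendsto_nhds_unique_of_frequently_eq
    (((h0.pow 2).mul continuousAt_const).sub (continuousAt_const.mul (h1.mul h2))).tendsto
    (((continuousAt_const.mul h3).mul h4).mul continuousAt_const).tendsto
    ((mem_closure_iff_frequently.1 (dense_compl_sq_eq_zpow hp0 z)).mono fun w hw ↦ ?_)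
  simp only [Set.mem_compl_iff, Set.mem_ofPred_eq, not_or, not_exists] at hw
  exact theta_addition_of_sq_ne_zpow hp0 hp1 ha hw.1 hw.2 hL

end Addition

theorem alpha_beta_theta_identity (p q : ℝ) (hp0 : 0 < p) (hp1 : p < 1)
    (hq0 : 0 < q) (hq1 : q < 1) (lam : ℂ) (z : ℂ) (hz : z ≠ 0)
    (h1 : theta p ((q : ℂ) ^ 2 * z) ≠ 0)
    (h2 : theta p (qpow q (2 * lam)) ≠ 0)
    (h3 : theta p (qpow q (-(2 * lam))) ≠ 0) :
    alphaF p q lam z * alphaF p q (-lam) z - betaF p q lam z * betaF p q (-lam) z =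
      (q : ℂ) ^ 2 * theta p (((q : ℂ) ^ 2)⁻¹ * z) / theta p ((q : ℂ) ^ 2 * z) := by
  have hq : (q : ℂ) ^ 2 ≠ 0 := pow_ne_zero 2 (by exact_mod_cast hq0.ne')
  have hL : qpow q (2 * lam) ≠ 0 := Complex.exp_ne_zero _
  have hqpow : Complex.exp (Real.log q) = q := by
    rw [← Complex.ofReal_exp, Real.exp_log hq0]
  have e1 : qpow q (-(2 * lam)) = (qpow q (2 * lam))⁻¹ := by
    rw [qpow, qpow, ← Complex.exp_neg, neg_mul]
  have e2 : qpow q (2 * (lam + 1)) = (q : ℂ) ^ 2 * qpow q (2 * lam) := by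
    rw [qpow, qpow, ← hqpow, ← Complex.exp_nat_mul, ← Complex.exp_add]
    congr 1
    push_cast
    ring
  have e3 : qpow q (2 * (-lam + 1)) = (q : ℂ) ^ 2 / qpow q (2 * lam) := by
    rw [qpow, qpow, ← hqpow, ← Complex.exp_nat_mul, ← Complex.exp_sub]
    congr 1
    push_cast
    ring
  have key := theta_addition hp0 hp1 hq hz hL
  rw [e1] at h3
  simp only [alphaF, betaF, mul_neg, neg_neg, e1, e2, e3]
  rw [inv_mul_eq_div, inv_mul_eq_div, mul_comm (qpow q (2 * lam)) z]
  generalize theta p (qpow q (2 * lam))⁻¹ = x at h3 key ⊢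
  generalize theta p (z * qpow q (2 * lam)) = y at key ⊢
  field_simp
  linear_combination key
end

section
/- Let B_n be the monoid generated by s₁,…,s_{n−1} subject to the braid relations s_i s_{i+1} s_i = s_{i+1} s_i s_{i+1} (1 ≤ i ≤ n−2) and s_i s_j = s_j s_i (|i−j| > 1), and define t_d ∈ B_n recursively by t₁ = 1 and t_d = t_{d−1} s_{d−1} s_{d−2} ⋯ s₁. Then for each 2 ≤ d ≤ n and each i < d there exists b ∈ B_n with t_d = s_i b. -/
/-- The defining relations of the positive braid monoid `B_n` on generators
`s₁, …, s_{n-1}` (generator `i : Fin (n-1)` stands for `s_{i+1}`):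
the braid relations `s_i s_{i+1} s_i = s_{i+1} s_i s_{i+1}` and the
commutation relations `s_i s_j = s_j s_i` for `|i - j| > 1`. -/
def braidRel (n : ℕ) : FreeMonoid (Fin (n - 1)) → FreeMonoid (Fin (n - 1)) → Prop :=
  fun u v =>
    (∃ i j : Fin (n - 1), (i : ℕ) + 1 = (j : ℕ) ∧
      u = FreeMonoid.of i * FreeMonoid.of j * FreeMonoid.of i ∧
      v = FreeMonoid.of j * FreeMonoid.of i * FreeMonoid.of j) ∨
    (∃ i j : Fin (n - 1), (i : ℕ) + 1 < (j : ℕ) ∧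
      u = FreeMonoid.of i * FreeMonoid.of j ∧
      v = FreeMonoid.of j * FreeMonoid.of i)

/-- The positive braid monoid `B_n`. -/
abbrev BraidMonoid (n : ℕ) := (conGen (braidRel n)).Quotient

/-- The generator `s_k` of `B_n` (mathematical indexing `1 ≤ k ≤ n-1`). -/
def sgen (n k : ℕ) : BraidMonoid n :=
  if h : k - 1 < n - 1 then (conGen (braidRel n)).mk' (FreeMonoid.of ⟨k - 1, h⟩) else 1

/-- The word (list of generator indices) of the element
`t_d = t_{d-1} s_{d-1} s_{d-2} ⋯ s₁`, `t₁ = 1`. -/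
def tword : ℕ → List ℕ
  | 0 => []
  | d + 1 => tword d ++ (List.range d).reverse.map (· + 1)

/-- The element `t_d ∈ B_n`. -/
def tEl (n d : ℕ) : BraidMonoid n := ((tword d).map (sgen n)).prod

/-- The descending product `s_d s_{d-1} ⋯ s₁` in `B_n`. -/
def descProd (n : ℕ) : ℕ → BraidMonoid n
  | 0 => 1
  | d + 1 => sgen n (d + 1) * descProd n d

theorem tEl_succ (n d : ℕ) : tEl n (d + 1) = tEl n d * descProd n d := by
  have key : (((List.range d).reverse.map (· + 1)).map (sgen n)).prod = descProd n d := by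
    induction d with
    | zero => rfl
    | succ d ih =>
      rw [List.range_succ, List.reverse_append, List.reverse_singleton, List.singleton_append,
        List.map_cons, List.map_cons, List.prod_cons, ih, descProd]
  simp only [tEl, tword, List.map_append, List.prod_append, key]

theorem sgen_commute {n i j : ℕ} (hi : 1 ≤ i) (hij : i + 1 < j) (hj : j < n) :
    Commute (sgen n j) (sgen n i) := by
  have hi' : i - 1 < n - 1 := by omega
  have hj' : j - 1 < n - 1 := by omega
  rw [sgen, sgen, dif_pos hi', dif_pos hj', Commute, SemiconjBy, ← map_mul, ← map_mul]
  symm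
  refine (Con.eq _).2 (ConGen.Rel.of _ _ (Or.inr ⟨⟨i - 1, hi'⟩, ⟨j - 1, hj'⟩, ?_, rfl, rfl⟩))
  change i - 1 + 1 < j - 1
  omega

theorem sgen_braid {n i : ℕ} (hi : 1 ≤ i) (hn : i + 1 < n) :
    sgen n i * sgen n (i + 1) * sgen n i = sgen n (i + 1) * sgen n i * sgen n (i + 1) := by
  have hi' : i - 1 < n - 1 := by omega
  have hj' : i + 1 - 1 < n - 1 := by omega
  rw [sgen, sgen, dif_pos hi', dif_pos hj']
  simp only [← map_mul]
  refine (Con.eq _).2 (ConGen.Rel.of _ _ (Or.inl ⟨⟨i - 1, hi'⟩, ⟨i + 1 - 1, hj'⟩, ?_, rfl, rfl⟩))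
  change i - 1 + 1 = i + 1 - 1
  omega

theorem sgen_commute_descProd {n d j : ℕ} (hdj : d + 1 < j) (hj : j < n) :
    Commute (sgen n j) (descProd n d) := by
  induction d with
  | zero => exact Commute.one_right _
  | succ d ih => exact (sgen_commute (by omega) hdj hj).mul_right (ih (by omega))

theorem sgen_commute_tEl {n d j : ℕ} (hdj : d < j) (hj : j < n) :
    Commute (sgen n j) (tEl n d) := by
  induction d with
  | zero => exact Commute.one_right _
  | succ d ih =>
    rw [tEl_succ]
    exact (ih (by omega)).mul_right (sgen_commute_descProd hdj hj)

theorem sgen_dvd_descProd_mul_descProd {n d : ℕ} (hd : d + 1 < n) :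
    sgen n (d + 1) ∣ descProd n d * descProd n (d + 1) := by
  induction d with
  | zero => exact ⟨1, by simp [descProd]⟩
  | succ d ih =>
    obtain ⟨x, hx⟩ := ih (by omega)
    refine ⟨sgen n (d + 1) * sgen n (d + 2) * x, ?_⟩
    calc descProd n (d + 1) * descProd n (d + 2)
        = sgen n (d + 1) * (descProd n d * sgen n (d + 2)) * descProd n (d + 1) := by
          simp only [descProd, mul_assoc]
      _ = sgen n (d + 1) * sgen n (d + 2) * (descProd n d * descProd n (d + 1)) := by
          rw [← (sgen_commute_descProd (show d + 1 < d + 2 by omega) hd).eq]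
          simp only [mul_assoc]
      _ = sgen n (d + 1) * sgen n (d + 2) * sgen n (d + 1) * x := by
          rw [hx]
          simp only [mul_assoc]
      _ = sgen n (d + 2) * (sgen n (d + 1) * sgen n (d + 2) * x) := by
          rw [sgen_braid (by omega) hd]
          simp only [mul_assoc]

theorem sgen_dvd_tEl_add_two {n d : ℕ} (hd : d + 1 < n) :
    sgen n (d + 1) ∣ tEl n (d + 2) := by
  obtain ⟨x, hx⟩ := sgen_dvd_descProd_mul_descProd hd
  refine ⟨tEl n d * x, ?_⟩
  rw [tEl_succ, tEl_succ, mul_assoc, hx, ← mul_assoc, ← mul_assoc,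
    (sgen_commute_tEl (Nat.lt_succ_self d) hd).eq]

theorem tEl_dvd_tEl {n d e : ℕ} (h : d ≤ e) : tEl n d ∣ tEl n e := by
  induction e, h using Nat.le_induction with
  | base => exact dvd_rfl
  | succ e _ ih => exact ih.trans ⟨_, tEl_succ n e⟩

theorem tEl_left_divisible (n d i : ℕ) (hd2 : 2 ≤ d) (hdn : d ≤ n)
    (hi1 : 1 ≤ i) (hid : i < d) :
    ∃ b : BraidMonoid n, tEl n d = sgen n i * b := by
  obtain ⟨k, rfl⟩ : ∃ k, i = k + 1 := ⟨i - 1, by omega⟩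
  exact (sgen_dvd_tEl_add_two (by omega)).trans (tEl_dvd_tEl hid)
end
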